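/- Let p and q be nonconstant polynomials over ℂ. Then cv(p∘q) ≤ cv(p) + deg(q) − 1. -/

import Mathlib

/-- The number of critical values of a polynomial `p`, i.e. the cardinality of the set
`p({z : p'(z) = 0})`. -/
noncomputable def numCriticalValues (p : Polynomial ℂ) : ℕ :=
  Set.ncard ((fun z => p.eval z) '' {z : ℂ | p.derivative.eval z = 0})

theorem numCriticalValues_comp_le
    (p q : Polynomial ℂ) (hp : 0 < p.natDegree) (hq : 0 < q.natDegree) :
    numCriticalValues (p.comp q) ≤ numCriticalValues p + q.natDegree - 1 := by
  classical
  have hne : ∀ r : Polynomial ℂ, 0 < r.natDegree → r.derivative ≠ 0 := by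
    intro r hr h
    have := Polynomial.natDegree_eq_zero_of_derivative_eq_zero h
    omega
  have hset : ∀ r : Polynomial ℂ, 0 < r.natDegree →
      {z : ℂ | r.derivative.eval z = 0} = (r.derivative.roots.toFinset : Set ℂ) := by
    intro r hr
    ext z
    simp [Polynomial.mem_roots (hne r hr)]
  have hsub : ((fun z => (p.comp q).eval z) '' {z : ℂ | (p.comp q).derivative.eval z = 0}) ⊆
      ((fun z => p.eval z) '' {z : ℂ | p.derivative.eval z = 0}) ∪
      ((fun z => (p.comp q).eval z) '' {z : ℂ | q.derivative.eval z = 0}) := by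
    rintro _ ⟨z, hz, rfl⟩
    simp only [Set.mem_setOf_eq, Polynomial.derivative_comp, Polynomial.eval_mul,
      Polynomial.eval_comp, mul_eq_zero] at hz
    rcases hz with hz | hz
    · exact Or.inr ⟨z, hz, rfl⟩
    · exact Or.inl ⟨q.eval z, hz, by simp [Polynomial.eval_comp]⟩
  have hfp : {z : ℂ | p.derivative.eval z = 0}.Finite := by
    rw [hset p hp]; exact Finset.finite_toSet _
  have hfq : {z : ℂ | q.derivative.eval z = 0}.Finite := by
    rw [hset q hq]; exact Finset.finite_toSet _
  have hcard : {z : ℂ | q.derivative.eval z = 0}.ncard ≤ q.natDegree - 1 := by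
    rw [hset q hq, Set.ncard_coe_finset]
    exact (Multiset.toFinset_card_le _).trans
      ((Polynomial.card_roots' _).trans (Polynomial.natDegree_derivative_le q))
  have h1 := Set.ncard_le_ncard hsub ((hfp.image _).union (hfq.image _))
  have h2 := Set.ncard_union_le ((fun z => p.eval z) '' {z : ℂ | p.derivative.eval z = 0})
      ((fun z => (p.comp q).eval z) '' {z : ℂ | q.derivative.eval z = 0})
  have h3 := Set.ncard_image_le (f := fun z => (p.comp q).eval z) hfq
  unfold numCriticalValues
  omega
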